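/- arXiv:1007.5508 — 3 statements merged into one kernel-verified Lean document; each statement's English description precedes it below -/
import Mathlib

section
/- The ℤ-submodule I_f^# of Q_f is contained in R_f and satisfies R_f·I_f^# ⊆ I_f^#; that is, I_f^# is an ideal of the ring R_f. -/
open Polynomial

noncomputable section

/-- The polynomial `f₀ Tⁿ + f₁ Tⁿ⁻¹ + ⋯ + fₙ` over `ℚ`. -/
def fpoly (n : ℕ) (f : ℕ → ℤ) : Polynomial ℚ :=
  ∑ i ∈ Finset.range (n + 1), Polynomial.C (f i : ℚ) * Polynomial.X ^ (n - i)

/-- `Q_f = ℚ[T]/(f₀ Tⁿ + ⋯ + fₙ)`. -/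
abbrev Qf (n : ℕ) (f : ℕ → ℤ) := AdjoinRoot (fpoly n f)

/-- `θ`, the image of `T` in `Q_f`. -/
def th (n : ℕ) (f : ℕ → ℤ) : Qf n f := AdjoinRoot.root _

/-- `ζ₀ = 1`, and `ζ_k = f₀ θ^k + f₁ θ^(k-1) + ⋯ + f_(k-1) θ` for `k ≥ 1`. -/
def zeta (n : ℕ) (f : ℕ → ℤ) (k : ℕ) : Qf n f :=
  if k = 0 then 1 else ∑ i ∈ Finset.range k, (f i : Qf n f) * th n f ^ (k - i)

/-- `R_f`, the ℤ-span of `ζ₀, …, ζ_(n-1)` in `Q_f`. -/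
def Rf (n : ℕ) (f : ℕ → ℤ) : Submodule ℤ (Qf n f) :=
  Submodule.span ℤ (Set.range fun k : Fin n => zeta n f k)

/-- `I_f^#`, the ℤ-span of `f₀, f₀θ + f₁, …, f₀θ^(n-1) + f₁θ^(n-2) + ⋯ + f_(n-1)`. -/
def Ish (n : ℕ) (f : ℕ → ℤ) : Submodule ℤ (Qf n f) :=
  Submodule.span ℤ (Set.range fun j : Fin n =>
    ∑ i ∈ Finset.range ((j : ℕ) + 1), (f i : Qf n f) * th n f ^ ((j : ℕ) - i))

/-- The generator `f₀θ^j + f₁θ^(j-1) + ⋯ + f_j` of `I_f^#`. -/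
def ishGen (n : ℕ) (f : ℕ → ℤ) (j : ℕ) : Qf n f :=
  ∑ i ∈ Finset.range (j + 1), (f i : Qf n f) * th n f ^ (j - i)

section

variable {n : ℕ} {f : ℕ → ℤ}

lemma ishGen_eq_sum_add (j : ℕ) :
    ishGen n f j = ∑ i ∈ Finset.range j, (f i : Qf n f) * th n f ^ (j - i) + f j := by
  simp [ishGen, Finset.sum_range_succ]

lemma ishGen_zero : ishGen n f 0 = f 0 := by
  simp [ishGen]

lemma ishGen_succ (j : ℕ) : ishGen n f (j + 1) = th n f * ishGen n f j + f (j + 1) := by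
  rw [ishGen_eq_sum_add, ishGen, Finset.mul_sum]
  congr 1
  refine Finset.sum_congr rfl fun i hi => ?_
  rw [Nat.succ_sub (Nat.lt_succ_iff.mp (Finset.mem_range.mp hi)), pow_succ]
  ring

lemma ishGen_self : ishGen n f n = 0 := by
  have h : AdjoinRoot.mk (fpoly n f) (fpoly n f) = 0 := AdjoinRoot.mk_self
  conv_lhs at h => arg 2; rw [fpoly]
  simpa [ishGen, th] using h

lemma zeta_of_ne_zero {k : ℕ} (hk : k ≠ 0) : zeta n f k = ishGen n f k - f k := by
  rw [zeta, if_neg hk, ishGen_eq_sum_add, add_sub_cancel_right]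

lemma ishGen_mem_Ish {j : ℕ} (hj : j ≤ n) : ishGen n f j ∈ Ish n f := by
  rcases hj.lt_or_eq with h | rfl
  · exact Submodule.subset_span ⟨⟨j, h⟩, rfl⟩
  · rw [ishGen_self]
    exact zero_mem _

lemma zeta_mem_Rf {k : ℕ} (hk : k < n) : zeta n f k ∈ Rf n f :=
  Submodule.subset_span ⟨⟨k, hk⟩, rfl⟩

lemma intCast_mul_mem {A : Type*} [Ring A] {M : Submodule ℤ A} (a : ℤ) {x : A} (hx : x ∈ M) :
    (a : A) * x ∈ M := by
  rw [← zsmul_eq_mul]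
  exact M.smul_mem a hx

lemma ishGen_mem_Rf {j : ℕ} (hj : j < n) : ishGen n f j ∈ Rf n f := by
  have hconst : (f j : Qf n f) ∈ Rf n f := by
    simpa [zeta] using intCast_mul_mem (f j) (zeta_mem_Rf (f := f) (Nat.zero_lt_of_lt hj))
  rcases eq_or_ne j 0 with rfl | h
  · rwa [ishGen_zero]
  · rw [← sub_add_cancel (ishGen n f j) (f j), ← zeta_of_ne_zero h]
    exact add_mem (zeta_mem_Rf hj) hconst

lemma ishGen_sub_mul_mem_Ish {k : ℕ} (hk : k ≤ n) {j : ℕ} (hj : j ≤ n) :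
    (ishGen n f k - f k) * ishGen n f j ∈ Ish n f := by
  induction k generalizing j with
  | zero => simp [ishGen_zero]
  | succ k ih =>
    rcases hj.lt_or_eq with h | rfl
    · have key : (ishGen n f (k + 1) - f (k + 1)) * ishGen n f j =
          (ishGen n f k - f k) * ishGen n f (j + 1) + f k * ishGen n f (j + 1)
            - f (j + 1) * ishGen n f k := by
        rw [ishGen_succ, ishGen_succ]
        ring
      rw [key]
      exact sub_mem (add_mem (ih (by lia) h) (intCast_mul_mem _ (ishGen_mem_Ish h)))
        (intCast_mul_mem _ (ishGen_mem_Ish (by lia)))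
    · simp [ishGen_self]

lemma zeta_mul_ishGen_mem_Ish {k : ℕ} (hk : k ≤ n) {j : ℕ} (hj : j ≤ n) :
    zeta n f k * ishGen n f j ∈ Ish n f := by
  rcases eq_or_ne k 0 with rfl | h
  · simpa [zeta] using ishGen_mem_Ish hj
  · rw [zeta_of_ne_zero h]
    exact ishGen_sub_mul_mem_Ish hk hj

end

/-- `I_f^#` is contained in `R_f` and is stable under multiplication by `R_f`;
that is, `I_f^#` is an ideal of the ring `R_f`. -/
theorem stmt5 (n : ℕ) (hn : 2 ≤ n) (f : ℕ → ℤ) (hf0 : f 0 ≠ 0) :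
    Ish n f ≤ Rf n f ∧
    ∀ r ∈ Rf n f, ∀ x ∈ Ish n f, r * x ∈ Ish n f := by
  refine ⟨Submodule.span_le.mpr ?_, fun r hr x hx => ?_⟩
  · rintro _ ⟨j, rfl⟩
    exact ishGen_mem_Rf j.isLt
  · induction hr, hx using Submodule.span_induction₂ with
    | mem_mem r x hr hx =>
      obtain ⟨k, rfl⟩ := hr
      obtain ⟨j, rfl⟩ := hx
      exact zeta_mul_ishGen_mem_Ish k.isLt.le j.isLt.le
    | zero_left => simp
    | zero_right => simp
    | add_left _ _ _ _ _ _ h₁ h₂ => rw [add_mul]; exact add_mem h₁ h₂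
    | add_right _ _ _ _ _ _ h₁ h₂ => rw [mul_add]; exact add_mem h₁ h₂
    | smul_left a _ _ _ _ h => rw [smul_mul_assoc]; exact Submodule.smul_mem _ a h
    | smul_right a _ _ _ _ h => rw [mul_smul_comm]; exact Submodule.smul_mem _ a h

end
end

section
/- If gcd(f_0, f_1, …, f_n) = 1 (f is primitive), then the product of submodules I_f·I_f^# equals R_f; that is, I_f^# is the inverse of the fractional R_f-ideal I_f. -/
open Polynomial

noncomputable section

/-- `I_f`, the `R_f`-submodule of `Q_f` generated by `1` and `θ`,
as a ℤ-submodule of `Q_f`. -/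
def If (n : ℕ) (f : ℕ → ℤ) : Submodule ℤ (Qf n f) :=
  Rf n f * Submodule.span ℤ {1, th n f}

/-- `θ · (f₀ θ^(k-1) + ⋯ + f_(k-1))`, which is `ζ_k` for `k ≥ 1` and vanishes for `k = 0`. -/
def zetaTail (n : ℕ) (f : ℕ → ℤ) (k : ℕ) : Qf n f :=
  ∑ i ∈ Finset.range k, (f i : Qf n f) * th n f ^ (k - i)

theorem zetaTail_zero (n : ℕ) (f : ℕ → ℤ) : zetaTail n f 0 = 0 := by
  simp [zetaTail]

theorem sum_range_succ_eq_zetaTail_add (n : ℕ) (f : ℕ → ℤ) (k : ℕ) :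
    ∑ i ∈ Finset.range (k + 1), (f i : Qf n f) * th n f ^ (k - i) =
      zetaTail n f k + (f k : Qf n f) := by
  simp [zetaTail, Finset.sum_range_succ]

theorem zetaTail_succ (n : ℕ) (f : ℕ → ℤ) (k : ℕ) :
    zetaTail n f (k + 1) = th n f * (zetaTail n f k + (f k : Qf n f)) := by
  rw [← sum_range_succ_eq_zetaTail_add, zetaTail, Finset.mul_sum]
  refine Finset.sum_congr rfl fun i hi => ?_
  rw [Nat.succ_sub (Nat.lt_succ_iff.mp (Finset.mem_range.mp hi)), pow_succ]
  ring

theorem zetaTail_self (n : ℕ) (f : ℕ → ℤ) : zetaTail n f n = -(f n : Qf n f) := by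
  have h : aeval (AdjoinRoot.root (fpoly n f)) (fpoly n f) = 0 := by
    rw [AdjoinRoot.aeval_eq, AdjoinRoot.mk_self]
  rw [eq_neg_iff_add_eq_zero, ← sum_range_succ_eq_zetaTail_add]
  conv_lhs at h => enter [2]; rw [fpoly]
  simpa [th] using h

theorem zetaTail_succ_mul (n : ℕ) (f : ℕ → ℤ) (i j : ℕ) :
    zetaTail n f (i + 1) * zetaTail n f j =
      zetaTail n f i * zetaTail n f (j + 1) + f i • zetaTail n f (j + 1) -
        f j • zetaTail n f (i + 1) := by
  simp only [zetaTail_succ, zsmul_eq_mul]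
  ring

theorem one_mem_Rf {n : ℕ} (hn : 0 < n) (f : ℕ → ℤ) : (1 : Qf n f) ∈ Rf n f :=
  Submodule.subset_span ⟨⟨0, hn⟩, by simp [zeta]⟩

theorem intCast_mem_Rf {n : ℕ} (hn : 0 < n) (f : ℕ → ℤ) (m : ℤ) : (m : Qf n f) ∈ Rf n f := by
  simpa using (Rf n f).smul_mem m (one_mem_Rf hn f)

theorem zetaTail_mem_Rf {n : ℕ} (hn : 0 < n) (f : ℕ → ℤ) {k : ℕ} (hk : k ≤ n) :
    zetaTail n f k ∈ Rf n f := by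
  rcases hk.eq_or_lt with rfl | hk
  · rw [zetaTail_self]
    exact neg_mem (intCast_mem_Rf hn f _)
  · rcases eq_or_ne k 0 with rfl | h0
    · rw [zetaTail_zero]
      exact zero_mem _
    · exact Submodule.subset_span ⟨⟨k, hk⟩, by simp [zeta, h0, zetaTail]⟩

theorem zetaTail_mul_mem_Rf {n : ℕ} (hn : 0 < n) (f : ℕ → ℤ) {i j : ℕ} (hi : i ≤ n)
    (hj : j ≤ n) : zetaTail n f i * zetaTail n f j ∈ Rf n f := by
  induction i generalizing j with
  | zero => simp [zetaTail_zero]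
  | succ i ih =>
    rcases hj.eq_or_lt with rfl | hj
    · rw [zetaTail_self, mul_comm, ← Int.cast_neg, ← zsmul_eq_mul]
      exact (Rf _ f).smul_mem _ (zetaTail_mem_Rf hn f hi)
    · rw [zetaTail_succ_mul]
      exact sub_mem (add_mem (ih (by omega) hj)
        ((Rf n f).smul_mem _ (zetaTail_mem_Rf hn f hj)))
        ((Rf n f).smul_mem _ (zetaTail_mem_Rf hn f hi))

theorem Rf_mul_Rf_le {n : ℕ} (hn : 0 < n) (f : ℕ → ℤ) : Rf n f * Rf n f ≤ Rf n f := by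
  conv_lhs => rw [Rf, Submodule.span_mul_span]
  rw [Submodule.span_le]
  rintro _ ⟨_, ⟨i, rfl⟩, _, ⟨j, rfl⟩, rfl⟩
  have hz (k : Fin n) : zeta n f k ∈ Rf n f := Submodule.subset_span ⟨k, rfl⟩
  by_cases hi : (i : ℕ) = 0
  · simpa [zeta, hi] using hz j
  by_cases hj : (j : ℕ) = 0
  · simpa [zeta, hj] using hz i
  simpa [zeta, hi, hj, zetaTail] using zetaTail_mul_mem_Rf hn f i.2.le j.2.le

theorem span_one_th_mul_Ish_le {n : ℕ} (hn : 0 < n) (f : ℕ → ℤ) :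
    Submodule.span ℤ {1, th n f} * Ish n f ≤ Rf n f := by
  rw [Ish, Submodule.span_mul_span, Submodule.span_le]
  rintro _ ⟨a, ha, _, ⟨j, rfl⟩, rfl⟩
  simp only [sum_range_succ_eq_zetaTail_add, SetLike.mem_coe]
  rcases ha with rfl | rfl
  · rw [one_mul]
    exact add_mem (zetaTail_mem_Rf hn f j.2.le) (intCast_mem_Rf hn f _)
  · rw [← zetaTail_succ]
    exact zetaTail_mem_Rf hn f j.2

theorem zetaTail_add_mem_Ish {n : ℕ} (f : ℕ → ℤ) {k : ℕ} (hk : k < n) :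
    zetaTail n f k + (f k : Qf n f) ∈ Ish n f :=
  Submodule.subset_span ⟨⟨k, hk⟩, sum_range_succ_eq_zetaTail_add n f k⟩

theorem zetaTail_mem_span_one_th_mul_Ish {n : ℕ} (f : ℕ → ℤ) {k : ℕ} (hk : k ≤ n) :
    zetaTail n f k ∈ Submodule.span ℤ {1, th n f} * Ish n f := by
  cases k with
  | zero => simp [zetaTail_zero]
  | succ k =>
    rw [zetaTail_succ]
    exact Submodule.mul_mem_mul (Submodule.subset_span (by simp)) (zetaTail_add_mem_Ish f hk)

theorem coeff_mem_span_one_th_mul_Ish {n : ℕ} (f : ℕ → ℤ) {k : ℕ} (hk : k ≤ n) :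
    (f k : Qf n f) ∈ Submodule.span ℤ {1, th n f} * Ish n f := by
  rcases hk.eq_or_lt with rfl | hk'
  · simpa [zetaTail_self] using neg_mem (zetaTail_mem_span_one_th_mul_Ish f hk)
  · have h : zetaTail n f k + (f k : Qf n f) ∈ Submodule.span ℤ {1, th n f} * Ish n f := by
      simpa using Submodule.mul_mem_mul (Submodule.subset_span (R := ℤ) (Set.mem_insert 1 {th n f}))
        (zetaTail_add_mem_Ish f hk')
    simpa using sub_mem h (zetaTail_mem_span_one_th_mul_Ish f hk)

theorem one_mem_span_one_th_mul_Ish {n : ℕ} {f : ℕ → ℤ}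
    (hprim : Finset.gcd (Finset.range (n + 1)) f = 1) :
    (1 : Qf n f) ∈ Submodule.span ℤ {1, th n f} * Ish n f := by
  obtain ⟨g, hg⟩ := Finset.gcd_eq_sum_mul (Finset.range (n + 1)) f
  have h : ∑ i ∈ Finset.range (n + 1), g i • (f i : Qf n f) = 1 := by
    rw [← Int.cast_one, ← hprim, hg]
    simp [mul_comm]
  refine Set.mem_of_eq_of_mem h.symm (sum_mem fun i hi => Submodule.smul_mem _ _ ?_)
  exact coeff_mem_span_one_th_mul_Ish f (Nat.lt_succ_iff.mp (Finset.mem_range.mp hi))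

/-- If `f` is primitive, then `I_f · I_f^# = R_f`: `I_f^#` is the inverse of the
fractional `R_f`-ideal `I_f`. -/
theorem stmt10 (n : ℕ) (hn : 2 ≤ n) (f : ℕ → ℤ) (hf0 : f 0 ≠ 0)
    (hprim : Finset.gcd (Finset.range (n + 1)) f = 1) :
    If n f * Ish n f = Rf n f := by
  have hn0 : 0 < n := by omega
  rw [If, mul_assoc]
  refine le_antisymm ?_ fun x hx => ?_
  · exact (mul_le_mul_right (span_one_th_mul_Ish_le hn0 f) _).trans (Rf_mul_Rf_le hn0 f)
  · simpa using Submodule.mul_mem_mul hx (one_mem_span_one_th_mul_Ish hprim)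

end
end

section
/- Fix an integer k with 0 ≤ k ≤ n−2. Every element of I_f^{n−2} is uniquely a ℤ-linear combination of the basis 1, θ, …, θ^{n−2}, ζ_{n−1}; let π : I_f^{n−2} → ℤ denote the ζ_{n−1}-coordinate with respect to this basis. Define elements u_1, …, u_n of I_f^k by u_i := θ^{i−1} for 1 ≤ i ≤ k+1 and u_i := ζ_{i−1} + f_{i−1} for k+2 ≤ i ≤ n, and elements v_1, …, v_n of I_f^{n−2−k} by v_j := f_0θ^{n−j} + f_1θ^{n−j−1} + ⋯ + f_{k+1−j}θ^{n−k−1} for 1 ≤ j ≤ k+1 and v_j := θ^{n−j} for k+2 ≤ j ≤ n. Then for all 1 ≤ i, j ≤ n, the product u_i·v_j lies in I_f^{n−2} and π(u_i·v_j) = 1 if i = j and π(u_i·v_j) = 0 if i ≠ j; that is, (u_i) and (v_j) are dual bases for the pairing (a, b) ↦ π(ab). -/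
open Polynomial

noncomputable section

/-- `I_f^k`, the `k`-th power of the `R_f`-module `I_f = (1, θ)` under multiplication of
ℤ-submodules of `Q_f` (with `I_f^0 = R_f`). -/
def Ifpow (n : ℕ) (f : ℕ → ℤ) (k : ℕ) : Submodule ℤ (Qf n f) :=
  Rf n f * (Submodule.span ℤ {1, th n f}) ^ k

/-- The basis `u₁, …, u_n` of `I_f^k`: `u_i = θ^(i-1)` for `1 ≤ i ≤ k+1` and
`u_i = ζ_(i-1) + f_(i-1)` for `k+2 ≤ i ≤ n`. -/
def ubasis (n : ℕ) (f : ℕ → ℤ) (k : ℕ) (i : ℕ) : Qf n f :=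
  if i ≤ k + 1 then th n f ^ (i - 1) else zeta n f (i - 1) + (f (i - 1) : Qf n f)

/-- The basis `v₁, …, v_n` of `I_f^(n-2-k)`:
`v_j = f₀θ^(n-j) + f₁θ^(n-j-1) + ⋯ + f_(k+1-j)θ^(n-k-1)` for `1 ≤ j ≤ k+1` and
`v_j = θ^(n-j)` for `k+2 ≤ j ≤ n`. -/
def vbasis (n : ℕ) (f : ℕ → ℤ) (k : ℕ) (j : ℕ) : Qf n f :=
  if j ≤ k + 1 then ∑ t ∈ Finset.range (k + 2 - j), (f t : Qf n f) * th n f ^ (n - j - t)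
  else th n f ^ (n - j)

/-- The truncation `f₀ θᵇ + f₁ θᵇ⁻¹ + ⋯ + f_b`. -/
def truncForm (n : ℕ) (f : ℕ → ℤ) (b : ℕ) : Qf n f :=
  ∑ t ∈ Finset.range (b + 1), (f t : Qf n f) * th n f ^ (b - t)

/-- The ℤ-span of the powers `θ^m` with `m < N`. -/
def lowSpan (n : ℕ) (f : ℕ → ℤ) (N : ℕ) : Submodule ℤ (Qf n f) :=
  Submodule.span ℤ ((fun m => th n f ^ m) '' (Finset.range N : Set ℕ))

section

variable {n : ℕ} {f : ℕ → ℤ}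

theorem sum_mul_pow_eq_th_mul_truncForm (b : ℕ) :
    ∑ t ∈ Finset.range (b + 1), (f t : Qf n f) * th n f ^ (b + 1 - t) =
      th n f * truncForm n f b := by
  rw [truncForm, Finset.mul_sum]
  refine Finset.sum_congr rfl fun t ht => ?_
  have : b + 1 - t = (b - t) + 1 := by grind
  rw [this]
  ring

theorem truncForm_zero : truncForm n f 0 = (f 0 : Qf n f) := by
  simp [truncForm]

theorem truncForm_succ (b : ℕ) :
    truncForm n f (b + 1) = th n f * truncForm n f b + (f (b + 1) : Qf n f) := by
  rw [← sum_mul_pow_eq_th_mul_truncForm, truncForm, Finset.sum_range_succ _ (b + 1)]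
  simp

theorem zeta_succ (b : ℕ) : zeta n f (b + 1) = th n f * truncForm n f b := by
  rw [← sum_mul_pow_eq_th_mul_truncForm, zeta, if_neg b.succ_ne_zero]

theorem zeta_add_coeff {b : ℕ} (hb : 1 ≤ b) :
    zeta n f b + (f b : Qf n f) = truncForm n f b := by
  obtain ⟨b, rfl⟩ := Nat.exists_eq_add_of_le' hb
  rw [zeta_succ, truncForm_succ]

theorem truncForm_self : truncForm n f n = 0 := by
  have h : AdjoinRoot.mk (fpoly n f) (fpoly n f) = 0 := AdjoinRoot.mk_self
  conv at h => enter [1, 2]; rw [fpoly]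
  simpa [truncForm, th] using h

theorem th_pow_mem_lowSpan {m N : ℕ} (h : m < N) : th n f ^ m ∈ lowSpan n f N :=
  Submodule.subset_span ⟨m, by simpa using h, rfl⟩

theorem lowSpan_mono {M N : ℕ} (h : M ≤ N) : lowSpan n f M ≤ lowSpan n f N :=
  Submodule.span_mono (Set.image_mono (by simpa using h))

theorem exists_sum_of_mem_lowSpan {N : ℕ} {x : Qf n f} (hx : x ∈ lowSpan n f N) :
    ∃ c : ℕ → ℤ, x = ∑ m ∈ Finset.range N, (c m : Qf n f) * th n f ^ m := by
  obtain ⟨c, hc⟩ := (Submodule.mem_span_image_finset_iff_exists_fun' ℤ).mp hx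
  exact ⟨c, by simpa using hc.symm⟩

theorem intCast_mul_mem_s12 (S : Submodule ℤ (Qf n f)) (a : ℤ) {x : Qf n f} (hx : x ∈ S) :
    (a : Qf n f) * x ∈ S := by
  rw [← zsmul_eq_mul]
  exact S.smul_mem a hx

theorem th_pow_mul_mem_lowSpan {N : ℕ} (c : ℕ) {x : Qf n f} (hx : x ∈ lowSpan n f N) :
    th n f ^ c * x ∈ lowSpan n f (c + N) := by
  induction hx using Submodule.span_induction with
  | mem x h =>
    obtain ⟨m, hm, rfl⟩ := h
    simp only [← pow_add]
    exact th_pow_mem_lowSpan (by simpa using hm)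
  | zero => simp
  | add x y _ _ hx hy => rw [mul_add]; exact add_mem hx hy
  | smul a x _ hx => rw [mul_smul_comm]; exact Submodule.smul_mem _ a hx

theorem truncForm_mul_mem_lowSpan {N : ℕ} (c : ℕ) {x : Qf n f} (hx : x ∈ lowSpan n f N) :
    truncForm n f c * x ∈ lowSpan n f (c + N) := by
  rw [truncForm, Finset.sum_mul]
  refine sum_mem fun t _ => ?_
  rw [mul_assoc]
  exact intCast_mul_mem_s12 _ _ (lowSpan_mono (by lia) (th_pow_mul_mem_lowSpan (c - t) hx))

theorem th_pow_mul_truncForm_mem_lowSpan (a b : ℕ) :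
    th n f ^ a * truncForm n f b ∈ lowSpan n f (a + b + 1) := by
  rw [mul_comm]
  exact lowSpan_mono (by lia)
    (truncForm_mul_mem_lowSpan b (th_pow_mem_lowSpan (Nat.lt_succ_self a)))

theorem th_pow_mul_truncForm_mem_lowSpan_of_le {a b : ℕ} (hb : b ≤ n) (hab : n ≤ a + b) :
    th n f ^ a * truncForm n f b ∈ lowSpan n f a := by
  induction a generalizing b with
  | zero =>
    obtain rfl : b = n := by lia
    simp [truncForm_self]
  | succ a ih =>
    rcases hb.eq_or_lt with rfl | hb
    · simp [truncForm_self]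
    · have h : th n f ^ (a + 1) * truncForm n f b =
          th n f ^ a * truncForm n f (b + 1) - (f (b + 1) : Qf n f) * th n f ^ a := by
        rw [truncForm_succ]
        ring
      rw [h]
      exact sub_mem (lowSpan_mono a.le_succ (ih hb (by lia)))
        (intCast_mul_mem_s12 _ _ (th_pow_mem_lowSpan a.lt_succ_self))

theorem th_pow_mul_truncForm_sub_mem_lowSpan (a b : ℕ) :
    th n f ^ a * truncForm n f b - (f 0 : Qf n f) * th n f ^ (a + b) ∈
      lowSpan n f (a + b) := by
  cases b with
  | zero => simp [truncForm_zero, mul_comm]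
  | succ b =>
    rw [truncForm, Finset.sum_range_succ', mul_add, Finset.mul_sum]
    have h : th n f ^ a * ((f 0 : Qf n f) * th n f ^ (b + 1 - 0)) =
        (f 0 : Qf n f) * th n f ^ (a + (b + 1)) := by
      rw [Nat.sub_zero]
      ring
    rw [h, add_sub_cancel_right]
    refine sum_mem fun t _ => ?_
    rw [mul_left_comm, ← pow_add]
    exact intCast_mul_mem_s12 _ _ (th_pow_mem_lowSpan (by lia))

theorem th_pow_mul_truncForm_sub_zeta_mem_lowSpan {a b m : ℕ} (h : a + b = m + 1) :
    th n f ^ a * truncForm n f b - zeta n f (m + 1) ∈ lowSpan n f (m + 1) := by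
  have h₁ := th_pow_mul_truncForm_sub_mem_lowSpan (n := n) (f := f) a b
  have h₂ := th_pow_mul_truncForm_sub_mem_lowSpan (n := n) (f := f) 1 m
  rw [h] at h₁
  rw [add_comm 1 m, pow_one, ← zeta_succ] at h₂
  simpa using sub_mem h₁ h₂

theorem vbasis_of_le {k j : ℕ} (hk : k + 2 ≤ n) (hj : j ≤ k + 1) :
    vbasis n f k j = th n f ^ (n - k - 1) * truncForm n f (k + 1 - j) := by
  rw [vbasis, if_pos hj, truncForm, Finset.mul_sum, show k + 2 - j = k + 1 - j + 1 by lia]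
  refine Finset.sum_congr rfl fun t ht => ?_
  rw [mul_left_comm, ← pow_add]
  congr 2
  grind

theorem ubasis_of_lt {k i : ℕ} (hi : k + 1 < i) :
    ubasis n f k i = truncForm n f (i - 1) := by
  rw [ubasis, if_neg (by lia), zeta_add_coeff (by lia)]

/-- The product of a power of `θ` and a truncation pairs to a Kronecker delta. -/
theorem th_pow_mul_truncForm_sub_ite_mem_lowSpan {a b i j : ℕ} (hn : 2 ≤ n) (hb : b ≤ n)
    (ha : a ≤ n - 1) (h : a + b + j = n - 1 + i) :
    th n f ^ a * truncForm n f b - ((if i = j then 1 else 0 : ℤ) : Qf n f) * zeta n f (n - 1) ∈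
      lowSpan n f (n - 1) := by
  rcases lt_trichotomy i j with hij | rfl | hij
  · rw [if_neg hij.ne]
    simpa using lowSpan_mono (by lia) (th_pow_mul_truncForm_mem_lowSpan (n := n) (f := f) a b)
  · obtain ⟨m, rfl⟩ : ∃ m, n = m + 2 := ⟨n - 2, by lia⟩
    simpa using th_pow_mul_truncForm_sub_zeta_mem_lowSpan (n := m + 2) (f := f)
      (a := a) (b := b) (m := m) (by lia)
  · rw [if_neg hij.ne']
    simpa using lowSpan_mono ha
      (th_pow_mul_truncForm_mem_lowSpan_of_le (n := n) (f := f) hb (by lia))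

theorem ubasis_mul_vbasis_sub_mem_lowSpan {k i j : ℕ} (hk : k + 2 ≤ n) (hi : 1 ≤ i)
    (hi' : i ≤ n) (hj : 1 ≤ j) (hj' : j ≤ n) :
    ubasis n f k i * vbasis n f k j -
        ((if i = j then 1 else 0 : ℤ) : Qf n f) * zeta n f (n - 1) ∈ lowSpan n f (n - 1) := by
  by_cases hik : i ≤ k + 1 <;> by_cases hjk : j ≤ k + 1
  · rw [vbasis_of_le hk hjk, ubasis, if_pos hik, ← mul_assoc, ← pow_add]
    exact th_pow_mul_truncForm_sub_ite_mem_lowSpan (by lia) (by lia) (by lia) (by lia)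
  · rw [ubasis, if_pos hik, vbasis, if_neg hjk, ← pow_add, if_neg (by lia)]
    simpa using th_pow_mem_lowSpan (n := n) (f := f) (by lia)
  · rw [vbasis_of_le hk hjk, ubasis_of_lt (by lia), if_neg (by lia), ← mul_assoc, mul_comm,
      mul_comm (truncForm n f (i - 1))]
    simpa using lowSpan_mono (by lia) (truncForm_mul_mem_lowSpan (n := n) (f := f) (k + 1 - j)
      (th_pow_mul_truncForm_mem_lowSpan_of_le (n := n) (f := f) (a := n - k - 1) (b := i - 1)
        (by lia) (by lia)))
  · rw [ubasis_of_lt (by lia), vbasis, if_neg hjk, mul_comm (truncForm n f (i - 1))]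
    exact th_pow_mul_truncForm_sub_ite_mem_lowSpan (by lia) (by lia) (by lia) (by lia)

/-- The ℤ-basis `1, θ, …, θ^k, ζ_(k+1), …, ζ_(n-1)` of `I_f^k`. -/
def powBasis (n : ℕ) (f : ℕ → ℤ) (k : ℕ) (i : Fin n) : Qf n f :=
  if (i : ℕ) ≤ k then th n f ^ (i : ℕ) else zeta n f i

theorem th_pow_mem_span_powBasis {k m : ℕ} (hm : m ≤ k) (hk : k < n) :
    th n f ^ m ∈ Submodule.span ℤ (Set.range (powBasis n f k)) :=
  Submodule.subset_span ⟨⟨m, by lia⟩, by simp [powBasis, hm]⟩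

theorem zeta_mem_span_powBasis {k m : ℕ} (hm : k < m) (hn : m < n) :
    zeta n f m ∈ Submodule.span ℤ (Set.range (powBasis n f k)) :=
  Submodule.subset_span ⟨⟨m, hn⟩, by simp [powBasis, hm]⟩

theorem lowSpan_le_span_powBasis {k : ℕ} (hk : k < n) :
    lowSpan n f (k + 1) ≤ Submodule.span ℤ (Set.range (powBasis n f k)) := by
  rw [lowSpan, Submodule.span_le]
  rintro _ ⟨m, hm, rfl⟩
  exact th_pow_mem_span_powBasis (by simpa [Nat.lt_succ_iff] using hm) hk

theorem zeta_mem_span_powBasis_of_pos {k m : ℕ} (hm : 1 ≤ m) (hn : m < n) (hk : k < n) :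
    zeta n f m ∈ Submodule.span ℤ (Set.range (powBasis n f k)) := by
  rcases lt_or_ge k m with h | h
  · exact zeta_mem_span_powBasis h hn
  · obtain ⟨b, rfl⟩ := Nat.exists_eq_add_of_le' hm
    rw [zeta_succ, ← pow_one (th n f)]
    exact lowSpan_le_span_powBasis hk
      (lowSpan_mono (by lia) (th_pow_mul_truncForm_mem_lowSpan 1 b))

theorem th_mul_zeta_mem_span_powBasis {k m : ℕ} (hm : 1 ≤ m) (hn : m < n) (hk : k + 1 < n) :
    th n f * zeta n f m ∈ Submodule.span ℤ (Set.range (powBasis n f (k + 1))) := by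
  have h : th n f * zeta n f m = zeta n f (m + 1) - (f m : Qf n f) * th n f ^ 1 := by
    rw [zeta_succ, ← zeta_add_coeff hm]
    ring
  rw [h]
  refine sub_mem ?_ (intCast_mul_mem_s12 _ _ (th_pow_mem_span_powBasis (by lia) hk))
  rcases (show m + 1 ≤ n from hn).eq_or_lt with h' | h'
  · have h₀ : zeta n f (m + 1) = (-f (m + 1) : ℤ) * th n f ^ 0 := by
      have := zeta_add_coeff (n := n) (f := f) (b := m + 1) (by lia)
      rw [h', truncForm_self] at this
      rw [h']
      push_cast
      linear_combination this
    rw [h₀]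
    exact intCast_mul_mem_s12 _ _ (th_pow_mem_span_powBasis (by lia) hk)
  · exact zeta_mem_span_powBasis_of_pos (by lia) h' hk

theorem span_powBasis_mul {k : ℕ} (hk : k + 1 < n) :
    Submodule.span ℤ (Set.range (powBasis n f k)) * Submodule.span ℤ {1, th n f} =
      Submodule.span ℤ (Set.range (powBasis n f (k + 1))) := by
  apply le_antisymm
  · rw [Submodule.span_mul_span, Submodule.span_le]
    rintro _ ⟨_, ⟨i, rfl⟩, y, hy, rfl⟩
    simp only [Set.mem_insert_iff, Set.mem_singleton_iff] at hy
    simp only [powBasis, SetLike.mem_coe]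
    rcases hy with rfl | rfl
    · rw [mul_one]
      split_ifs with h
      · exact th_pow_mem_span_powBasis (by lia) hk
      · exact zeta_mem_span_powBasis_of_pos (by lia) i.2 hk
    · split_ifs with h
      · rw [← pow_succ]
        exact th_pow_mem_span_powBasis (by lia) hk
      · rw [mul_comm]
        exact th_mul_zeta_mem_span_powBasis (by lia) i.2 hk
  · rw [Submodule.span_le]
    have h₁ : (1 : Qf n f) ∈ Submodule.span ℤ {1, th n f} := Submodule.subset_span (by simp)
    have h₂ : th n f ∈ Submodule.span ℤ {1, th n f} := Submodule.subset_span (by simp)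
    rintro _ ⟨i, rfl⟩
    simp only [powBasis, SetLike.mem_coe]
    split_ifs with h
    · rcases h.eq_or_lt with h | h
      · rw [h, pow_succ]
        exact Submodule.mul_mem_mul (th_pow_mem_span_powBasis le_rfl (by lia)) h₂
      · rw [← mul_one (th n f ^ _)]
        exact Submodule.mul_mem_mul (th_pow_mem_span_powBasis (by lia) (by lia)) h₁
    · rw [← mul_one (zeta n f _)]
      exact Submodule.mul_mem_mul (zeta_mem_span_powBasis (by lia) i.2) h₁

theorem Ifpow_eq_span_powBasis {k : ℕ} (hk : k < n) :
    Ifpow n f k = Submodule.span ℤ (Set.range (powBasis n f k)) := by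
  induction k with
  | zero =>
    rw [Ifpow, pow_zero, mul_one, Rf]
    congr 2
    funext i
    rw [powBasis]
    split_ifs with h
    · simp [Nat.le_zero.mp h, zeta]
    · rfl
  | succ k ih =>
    rw [← span_powBasis_mul hk, ← ih (by lia), Ifpow, Ifpow, pow_succ, mul_assoc]

theorem coeff_fpoly_self : (fpoly n f).coeff n = (f 0 : ℚ) := by
  rw [fpoly, finsetSum_coeff, Finset.sum_eq_single 0]
  · simp
  · intro i hi h
    simp only [coeff_C_mul, coeff_X_pow]
    grind
  · simp

theorem le_natDegree_fpoly (hf0 : f 0 ≠ 0) : n ≤ (fpoly n f).natDegree :=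
  le_natDegree_of_ne_zero (by simpa [coeff_fpoly_self] using hf0)

theorem linearIndependent_th_pow (hf0 : f 0 ≠ 0) :
    LinearIndependent ℤ (fun i : Fin n => th n f ^ (i : ℕ)) := by
  have h0 : fpoly n f ≠ 0 := fun h => by
    have := coeff_fpoly_self (n := n) (f := f)
    simp [h, hf0, eq_comm] at this
  have h := (((AdjoinRoot.powerBasis h0).basis.linearIndependent.comp
    (Fin.castLE (by simpa using le_natDegree_fpoly hf0))
    (Fin.castLE_injective _)).restrict_scalars
    (R := ℤ) fun a b hab => by simpa using hab)
  convert h using 1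
  funext i
  simp [th]

theorem linearIndependent_powBasis {m : ℕ} {f : ℕ → ℤ} (hf0 : f 0 ≠ 0) :
    LinearIndependent ℤ (powBasis (m + 2) f m) := by
  have hlow := th_pow_mul_truncForm_sub_mem_lowSpan (n := m + 2) (f := f) 1 m
  rw [add_comm 1 m, pow_one, ← zeta_succ] at hlow
  obtain ⟨c, hc⟩ := exists_sum_of_mem_lowSpan hlow
  have hz := eq_add_of_sub_eq hc
  have hli := Fintype.linearIndependent_iff.mp (linearIndependent_th_pow (n := m + 2) hf0)
  rw [Fintype.linearIndependent_iff]
  intro g hg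
  set a := g (Fin.last (m + 1))
  have key := hli (Fin.snoc (fun i : Fin (m + 1) => g i.castSucc + a * c i) (a * f 0)) (by
    rw [Fin.sum_univ_castSucc] at hg ⊢
    simp only [powBasis, Fin.val_castSucc, Fin.val_last, Fin.snoc_castSucc, Fin.snoc_last,
      zsmul_eq_mul] at hg ⊢
    rw [if_neg (by lia), hz, ← Fin.sum_univ_eq_sum_range
      (fun i => (c i : Qf (m + 2) f) * th (m + 2) f ^ i)] at hg
    rw [← hg, mul_add, Finset.mul_sum, ← add_assoc, ← Finset.sum_add_distrib]
    congr 1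
    · refine Finset.sum_congr rfl fun i _ => ?_
      rw [if_pos (by lia)]
      push_cast
      ring
    · push_cast
      ring)
  have ha : a = 0 := by simpa [hf0] using key (Fin.last (m + 1))
  intro i
  cases i using Fin.lastCases with
  | last => exact ha
  | cast i => simpa [ha] using key i.castSucc

end

/-- Every element of `I_f^(n-2)` is uniquely a ℤ-linear combination of
`1, θ, …, θ^(n-2), ζ_(n-1)`; the `u_i` and `v_j` are dual bases of `I_f^k` and
`I_f^(n-2-k)` with respect to the pairing `(a, b) ↦ π(ab)`, where `π` is the
`ζ_(n-1)`-coordinate: i.e. `u_i v_j ∈ I_f^(n-2)` and `π(u_i v_j) = δ_(ij)`. -/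
theorem stmt12 (n : ℕ) (hn : 2 ≤ n) (f : ℕ → ℤ) (hf0 : f 0 ≠ 0)
    (k : ℕ) (hk : k ≤ n - 2) :
    (Ifpow n f (n - 2) =
      Submodule.span ℤ (Set.range fun i : Fin n =>
        if (i : ℕ) ≤ n - 2 then th n f ^ (i : ℕ) else zeta n f i)) ∧
    LinearIndependent ℤ (fun i : Fin n =>
        if (i : ℕ) ≤ n - 2 then th n f ^ (i : ℕ) else zeta n f i) ∧
    ∀ i j : ℕ, 1 ≤ i → i ≤ n → 1 ≤ j → j ≤ n →
      ubasis n f k i * vbasis n f k j ∈ Ifpow n f (n - 2) ∧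
      ∃ c : ℕ → ℤ,
        ubasis n f k i * vbasis n f k j =
          (∑ m ∈ Finset.range (n - 1), (c m : Qf n f) * th n f ^ m) +
            ((if i = j then 1 else 0 : ℤ) : Qf n f) * zeta n f (n - 1) := by
  have hI := Ifpow_eq_span_powBasis (n := n) (f := f) (k := n - 2) (by lia)
  refine ⟨hI, ?_, fun i j hi hi' hj hj' => ?_⟩
  · obtain ⟨m, rfl⟩ := Nat.exists_eq_add_of_le' hn
    exact linearIndependent_powBasis hf0
  have h := ubasis_mul_vbasis_sub_mem_lowSpan (n := n) (f := f) (k := k) (by lia) hi hi' hj hj'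
  constructor
  · rw [hI]
    rw [show n - 1 = n - 2 + 1 by lia] at h
    have h₁ := add_mem (lowSpan_le_span_powBasis (by lia) h)
      (intCast_mul_mem_s12 _ (if i = j then 1 else 0)
        (zeta_mem_span_powBasis (f := f) (k := n - 2) (Nat.lt_succ_self (n - 2)) (by lia)))
    rwa [sub_add_cancel] at h₁
  · obtain ⟨c, hc⟩ := exists_sum_of_mem_lowSpan h
    exact ⟨c, eq_add_of_sub_eq hc⟩

end
end
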